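/- arXiv:1109.1976 — 2 statements merged into one kernel-verified Lean document; each statement's English description precedes it below -/
import Mathlib

section
/- Let B be a separable complex Banach space and (T_t)_{t≥0} a strongly continuous semigroup on B. Define B_0 = {x ∈ B : ‖T_t x‖ → 0 as t → ∞} and B_∞ = {x ∈ B : for every ε > 0 there exist t > 0 and w ∈ B with ‖w‖ < ε and ‖T_t w − x‖ < ε}. If B_0 and B_∞ are both dense in B, then (T_t) is hypercyclic. -/
open Filter Topology TopologicalSpace

/-- **Birkhoff transitivity theorem** for a family of continuous self-maps. -/
theorem exists_denseRange_of_transitive {X ι : Type*} [TopologicalSpace X] [BaireSpace X]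
    [SecondCountableTopology X] [Nonempty X] (f : ι → X → X) (hf : ∀ i, Continuous (f i))
    (h : ∀ U V : Set X, IsOpen U → U.Nonempty → IsOpen V → V.Nonempty →
      ∃ i, ∃ x ∈ U, f i x ∈ V) :
    ∃ v, DenseRange fun i => f i v := by
  have hb := isBasis_countableBasis X
  have hd : Dense (⋂ V ∈ countableBasis X, ⋃ i, f i ⁻¹' V) := by
    refine dense_biInter_of_isOpen
      (fun V hV => isOpen_iUnion fun i => (hb.isOpen hV).preimage (hf i))
      (countable_countableBasis X) fun V hV => dense_iff_inter_open.2 fun U hU hUne => ?_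
    obtain ⟨i, x, hx, hxV⟩ :=
      h U V hU hUne (hb.isOpen hV) (nonempty_of_mem_countableBasis hV)
    exact ⟨x, hx, Set.mem_iUnion.2 ⟨i, hxV⟩⟩
  obtain ⟨v, hv⟩ := hd.nonempty
  refine ⟨v, hb.dense_iff.2 fun V hV _ => ?_⟩
  obtain ⟨i, hi⟩ := Set.mem_iUnion.1 (Set.mem_iInter₂.1 hv V hV)
  exact ⟨f i v, hi, i, rfl⟩

section Semigroup

variable {𝕜 B : Type*} [NontriviallyNormedField 𝕜] [NormedAddCommGroup B] [NormedSpace 𝕜 B]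
  [CompleteSpace B] {T : ℝ → B →L[𝕜] B}

/-- A strongly continuous family of operators is uniformly bounded near `0`. -/
theorem exists_norm_le_of_strongly_continuous_zero
    (hTcont : ∀ x : B, Tendsto (fun t : ℝ => ‖T t x - x‖) (𝓝[>] 0) (𝓝 0)) :
    ∃ δ > 0, ∃ M, ∀ t, 0 < t → t ≤ δ → ‖T t‖ ≤ M := by
  by_contra! H
  choose u hu0 hu1 hu2 using fun n : ℕ =>
    H (1 / ((n : ℝ) + 1)) Nat.one_div_pos_of_nat n
  have hu : Tendsto u atTop (𝓝[>] 0) :=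
    tendsto_nhdsWithin_iff.2 ⟨squeeze_zero (fun n => (hu0 n).le) hu1
      tendsto_one_div_add_atTop_nhds_zero_nat, .of_forall hu0⟩
  obtain ⟨C, hC⟩ := banach_steinhaus (g := fun n => T (u n)) fun x => by
    have hx : Tendsto (fun n => T (u n) x) atTop (𝓝 x) :=
      tendsto_iff_norm_sub_tendsto_zero.2 ((hTcont x).comp hu)
    obtain ⟨C, hC⟩ := hx.norm.bddAbove_range
    exact ⟨C, fun n => hC ⟨n, rfl⟩⟩
  obtain ⟨n, hn⟩ := exists_nat_gt C
  exact (hn.trans (hu2 n)).not_ge (hC n)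

/-- A strongly continuous semigroup is uniformly bounded on bounded time intervals. -/
theorem exists_norm_le_of_strongly_continuous
    (hTsemi : ∀ t s : ℝ, 0 ≤ t → 0 ≤ s → T (t + s) = (T t).comp (T s))
    (hTcont : ∀ x : B, Tendsto (fun t : ℝ => ‖T t x - x‖) (𝓝[>] 0) (𝓝 0)) (R : ℝ) :
    ∃ M > 0, ∀ t, 0 < t → t ≤ R → ‖T t‖ ≤ M := by
  obtain ⟨δ, hδ, M, hM⟩ := exists_norm_le_of_strongly_continuous_zero hTcont
  have key : ∀ n : ℕ, ∃ C > 0, ∀ t, 0 < t → t ≤ n * δ → ‖T t‖ ≤ C := by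
    intro n
    induction n with
    | zero => exact ⟨1, one_pos, fun t ht ht' => by simp at ht'; linarith⟩
    | succ n ih =>
      obtain ⟨C, hC0, hC⟩ := ih
      refine ⟨max (max M C) (M * C), lt_max_of_lt_left (lt_max_of_lt_right hC0),
        fun t ht ht' => ?_⟩
      rcases le_or_gt t δ with h | h
      · exact (hM t ht h).trans ((le_max_left _ _).trans (le_max_left _ _))
      · push_cast at ht'
        have h1 := hC (t - δ) (by linarith) (by linarith)
        have h2 := hM δ hδ le_rfl
        have h3 := hTsemi δ (t - δ) hδ.le (by linarith)
        rw [add_sub_cancel] at h3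
        rw [h3]
        refine ((T δ).opNorm_comp_le _).trans (le_max_of_le_right ?_)
        exact mul_le_mul h2 h1 (norm_nonneg _) ((norm_nonneg _).trans h2)
  obtain ⟨n, hn⟩ := exists_nat_ge (R / δ)
  obtain ⟨C, hC0, hC⟩ := key n
  exact ⟨C, hC0, fun t ht h => hC t ht (h.trans ((div_le_iff₀ hδ).1 hn))⟩

/-- A nonzero vector that is approximable by images of small vectors is so approximable at
arbitrarily large times. -/
theorem exists_large_time_of_approximable
    (hTsemi : ∀ t s : ℝ, 0 ≤ t → 0 ≤ s → T (t + s) = (T t).comp (T s))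
    (hTcont : ∀ x : B, Tendsto (fun t : ℝ => ‖T t x - x‖) (𝓝[>] 0) (𝓝 0))
    {y : B} (hy0 : y ≠ 0)
    (hy : ∀ ε > 0, ∃ t > (0 : ℝ), ∃ w : B, ‖w‖ < ε ∧ ‖T t w - y‖ < ε)
    (R : ℝ) {ε : ℝ} (hε : 0 < ε) :
    ∃ t > 0, R < t ∧ ∃ w : B, ‖w‖ < ε ∧ ‖T t w - y‖ < ε := by
  obtain ⟨M, hM0, hM⟩ := exists_norm_le_of_strongly_continuous hTsemi hTcont R
  have hy1 : 0 < ‖y‖ := norm_pos_iff.2 hy0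
  have hη : 0 < ‖y‖ / (M + 1) := by positivity
  obtain ⟨t, ht, w, hw, hTw⟩ := hy (min ε (‖y‖ / (M + 1))) (lt_min hε hη)
  refine ⟨t, ht, ?_, w, hw.trans_le (min_le_left _ _), hTw.trans_le (min_le_left _ _)⟩
  by_contra! htR
  have h1 := hw.trans_le (min_le_right _ _)
  have h2 := hTw.trans_le (min_le_right _ _)
  have h3 : ‖T t w‖ ≤ M * (‖y‖ / (M + 1)) :=
    (T t).le_of_opNorm_le_of_le (hM t ht htR) h1.le
  have h4 : ‖y‖ ≤ ‖T t w‖ + ‖T t w - y‖ := norm_le_norm_add_norm_sub _ _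
  have h5 : M * (‖y‖ / (M + 1)) + ‖y‖ / (M + 1) = ‖y‖ := by field_simp
  linarith

end Semigroup

/-- Desch–Schappacher–Webb criterion: if `B₀` (points whose orbit tends to `0`) and
`B_∞` (points approximable by images of small vectors) are dense in a separable Banach
space `B`, then the strongly continuous semigroup `(T_t)` is hypercyclic. -/
theorem stmt_0
    {B : Type*} [NormedAddCommGroup B] [NormedSpace ℂ B] [CompleteSpace B]
    [TopologicalSpace.SeparableSpace B]
    (T : ℝ → B →L[ℂ] B)
    (hT0 : T 0 = ContinuousLinearMap.id ℂ B)
    (hTsemi : ∀ t s : ℝ, 0 ≤ t → 0 ≤ s → T (t + s) = (T t).comp (T s))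
    (hTcont : ∀ x : B,
      Filter.Tendsto (fun t : ℝ => ‖T t x - x‖) (nhdsWithin 0 (Set.Ioi 0)) (nhds 0))
    (hB0 : Dense {x : B | Filter.Tendsto (fun t : ℝ => T t x) Filter.atTop (nhds 0)})
    (hBinf : Dense {x : B | ∀ ε > 0, ∃ t > (0 : ℝ), ∃ w : B, ‖w‖ < ε ∧ ‖T t w - x‖ < ε}) :
    ∃ v : B, Dense {y : B | ∃ t : ℝ, 0 ≤ t ∧ T t v = y} := by
  have : SecondCountableTopology B := UniformSpace.secondCountable_of_separable B
  obtain ⟨v, hv⟩ := exists_denseRange_of_transitive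
    (fun (t : {t : ℝ // 0 ≤ t}) x => T t x) (fun t => (T t).continuous) <| by
      intro U V hU hUne hV hVne
      obtain ⟨x, hxU, hx⟩ := hB0.inter_open_nonempty U hU hUne
      obtain ⟨y, hyV, hy⟩ := hBinf.inter_open_nonempty V hV hVne
      obtain ⟨ε, hε, hεU⟩ := Metric.isOpen_iff.1 hU x hxU
      obtain ⟨r, hr, hrV⟩ := Metric.isOpen_iff.1 hV y hyV
      obtain ⟨R, hR⟩ := eventually_atTop.1 (hx.eventually (Metric.ball_mem_nhds 0 (half_pos hr)))
      have hsmall : ∀ t ≥ R, ‖T t x‖ < r / 2 := fun t ht => by simpa using hR t ht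
      rcases eq_or_ne y 0 with rfl | hy0
      · refine ⟨⟨max R 0, le_max_right _ _⟩, x, hxU, hrV ?_⟩
        have := hsmall (max R 0) (le_max_left _ _)
        rw [mem_ball_zero_iff]
        linarith
      · obtain ⟨t, ht, htR, w, hw, hTw⟩ := exists_large_time_of_approximable hTsemi hTcont
          hy0 hy R (lt_min hε (half_pos hr))
        refine ⟨⟨t, ht.le⟩, x + w, hεU ?_, hrV ?_⟩
        · simpa [mem_ball_iff_norm] using hw.trans_le (min_le_left _ _)
        · rw [mem_ball_iff_norm, map_add, add_sub_assoc]
          have h1 := hsmall t htR.le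
          have h2 := hTw.trans_le (min_le_right _ _)
          linarith [norm_add_le (T t x) (T t w - y)]
  refine ⟨v, hv.mono ?_⟩
  rintro _ ⟨t, rfl⟩
  exact ⟨t, t.2, rfl⟩
end

section
/- Let B be a complex Banach space and (T_t)_{t≥0} a strongly continuous semigroup on B. If the set of purely imaginary numbers λ ∈ iℝ for which there exists a nonzero v ∈ B with T_t v = e^{λt} v for all t ≥ 0 is finite, then (T_t) is not subspace-chaotic; that is, there is no closed subspace V ≠ {0} of B with T_t V ⊆ V for all t ≥ 0 such that the restricted semigroup (T_t|_V) is chaotic on V. -/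
open Filter Topology Set MeasureTheory

/-- A strongly continuous one-parameter semigroup of bounded operators, indexed by `t ≥ 0`. -/
structure IsStronglyContinuousSemigroup {B : Type*} [NormedAddCommGroup B] [NormedSpace ℂ B]
    (T : ℝ → B →L[ℂ] B) : Prop where
  zero : T 0 = ContinuousLinearMap.id ℂ B
  add : ∀ t s : ℝ, 0 ≤ t → 0 ≤ s → T (t + s) = (T t).comp (T s)
  tendsto : ∀ x : B, Tendsto (fun t : ℝ => ‖T t x - x‖) (𝓝[>] 0) (𝓝 0)

/-- A continuous function on `[0, p]` with equal endpoint values, all of whose Fourier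
coefficients vanish, vanishes on `[0, p)`. -/
theorem eq_zero_of_fourierCoeff_integral_eq_zero {p : ℝ} (hp : 0 < p) {g : ℝ → ℂ}
    (hg : ContinuousOn g (Icc 0 p)) (hgp : g 0 = g p)
    (hcoeff : ∀ n : ℤ,
      ∫ s in (0 : ℝ)..p, Complex.exp (-(2 * Real.pi * Complex.I * n / p * s)) * g s = 0) :
    ∀ s ∈ Ico 0 p, g s = 0 := by
  intro s hs
  have : Fact (0 < p) := ⟨hp⟩
  let f : C(AddCircle p, ℂ) := ⟨AddCircle.liftIco p 0 g, AddCircle.liftIco_zero_continuous hgp hg⟩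
  have hf (n : ℤ) : fourierCoeff f n = 0 := by
    change fourierCoeff (AddCircle.liftIco p 0 g) n = 0
    rw [fourierCoeff_eq_intervalIntegral _ n 0, zero_add]
    convert! smul_zero (1 / p)
    rw [← hcoeff n]
    refine intervalIntegral.integral_congr_Ioo_of_le hp.le fun x hx => ?_
    simp only [AddCircle.liftIco_zero_coe_apply (Ioo_subset_Ico_self hx), fourier_coe_apply,
      smul_eq_mul]
    congr 2
    push_cast
    ring
  have hsum : Summable (fourierCoeff f) := by
    rw [funext hf]
    exact summable_zero
  have h := has_pointwise_sum_fourier_series_of_summable hsum (s : AddCircle p)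
  simp only [hf, zero_smul] at h
  rw [← AddCircle.liftIco_zero_coe_apply (f := g) hs]
  exact h.unique hasSum_zero

namespace IsStronglyContinuousSemigroup

variable {B : Type*} [NormedAddCommGroup B] [NormedSpace ℂ B] {T : ℝ → B →L[ℂ] B}

theorem add_apply (hT : IsStronglyContinuousSemigroup T) {t s : ℝ} (ht : 0 ≤ t) (hs : 0 ≤ s)
    (x : B) : T (t + s) x = T t (T s x) := by
  rw [hT.add t s ht hs]
  rfl

theorem zero_apply (hT : IsStronglyContinuousSemigroup T) (x : B) : T 0 x = x := by
  rw [hT.zero]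
  rfl

theorem commute (hT : IsStronglyContinuousSemigroup T) {t s : ℝ} (ht : 0 ≤ t) (hs : 0 ≤ s) :
    Commute (T t) (T s) := by
  ext x
  change T t (T s x) = T s (T t x)
  rw [← hT.add_apply ht hs, ← hT.add_apply hs ht, add_comm]

theorem tendsto_norm_sub_nhdsGE (hT : IsStronglyContinuousSemigroup T) (x : B) :
    Tendsto (fun t : ℝ => ‖T t x - x‖) (𝓝[≥] 0) (𝓝 0) := by
  rw [← Ioi_insert, nhdsWithin_insert, tendsto_sup]
  refine ⟨?_, hT.tendsto x⟩
  rw [tendsto_pure_left]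
  intro s hs
  simpa [hT.zero_apply] using mem_of_mem_nhds hs

theorem commute_aeval (hT : IsStronglyContinuousSemigroup T) (q : Polynomial ℂ) {t : ℝ}
    (ht : 0 ≤ t) : Commute (T t) (Polynomial.aeval (T 1) q) := by
  induction q using Polynomial.induction_on' with
  | add p q hp hq => rw [map_add]; exact hp.add_right hq
  | monomial n a =>
    rw [Polynomial.aeval_monomial]
    exact (Algebra.commute_algebraMap_right a _).mul_right
      ((hT.commute ht zero_le_one).pow_right n)

theorem apply_aeval_apply (hT : IsStronglyContinuousSemigroup T) (q : Polynomial ℂ) {t : ℝ}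
    (ht : 0 ≤ t) (x : B) :
    T t (Polynomial.aeval (T 1) q x) = Polynomial.aeval (T 1) q (T t x) :=
  DFunLike.congr_fun (hT.commute_aeval q ht).eq x

section Complete

variable [CompleteSpace B]

theorem exists_norm_le_near_zero (hT : IsStronglyContinuousSemigroup T) :
    ∃ δ > 0, ∃ M : ℝ, ∀ t ∈ Icc 0 δ, ‖T t‖ ≤ M := by
  by_contra! h
  choose t ht hM using fun n : ℕ => h (1 / ((n : ℝ) + 1)) (by positivity) n
  have htend : Tendsto t atTop (𝓝[≥] 0) :=
    tendsto_nhdsWithin_iff.2 ⟨squeeze_zero (fun n => (ht n).1) (fun n => (ht n).2)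
      tendsto_one_div_add_atTop_nhds_zero_nat, .of_forall fun n => (ht n).1⟩
  obtain ⟨C, hC⟩ := banach_steinhaus (g := fun n => T (t n)) fun x => by
    obtain ⟨C, hC⟩ := ((hT.tendsto_norm_sub_nhdsGE x).comp htend).bddAbove_range
    refine ⟨C + ‖x‖, fun n => ?_⟩
    have h₁ : ‖T (t n) x - x‖ ≤ C := hC ⟨n, rfl⟩
    linarith [norm_le_norm_sub_add (T (t n) x) x]
  obtain ⟨n, hn⟩ := exists_nat_gt C
  linarith [hC n, hM n]

theorem exists_norm_le (hT : IsStronglyContinuousSemigroup T) (R : ℝ) :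
    ∃ M : ℝ, ∀ t ∈ Icc 0 R, ‖T t‖ ≤ M := by
  obtain ⟨δ, hδ, M, hM⟩ := hT.exists_norm_le_near_zero
  have hM0 : 0 ≤ M := (norm_nonneg _).trans (hM 0 ⟨le_rfl, hδ.le⟩)
  have key (n : ℕ) : ∃ K : ℝ, ∀ t ∈ Icc 0 (n * δ), ‖T t‖ ≤ K := by
    induction n with
    | zero =>
      refine ⟨‖T 0‖, fun t ht => ?_⟩
      rw [show t = 0 by simpa using ht]
    | succ n ih =>
      obtain ⟨K, hK⟩ := ih
      refine ⟨max M (M * K), fun t ht => ?_⟩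
      rcases le_total t δ with h | h
      · exact (hM t ⟨ht.1, h⟩).trans (le_max_left _ _)
      · have hmem : t - δ ∈ Icc 0 (n * δ) := by
          have := ht.2
          push_cast at this
          constructor <;> linarith
        have hsplit := hT.add δ (t - δ) hδ.le hmem.1
        rw [add_sub_cancel] at hsplit
        rw [hsplit]
        calc _ ≤ ‖T δ‖ * ‖T (t - δ)‖ := ContinuousLinearMap.opNorm_comp_le _ _
          _ ≤ M * K := mul_le_mul (hM δ ⟨hδ.le, le_rfl⟩) (hK _ hmem) (norm_nonneg _) hM0
          _ ≤ _ := le_max_right _ _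
  obtain ⟨n, hn⟩ := exists_nat_gt (R / δ)
  obtain ⟨K, hK⟩ := key n
  exact ⟨K, fun t ht => hK t ⟨ht.1, ht.2.trans ((div_lt_iff₀ hδ).1 hn).le⟩⟩

theorem continuousOn_orbit (hT : IsStronglyContinuousSemigroup T) (x : B) :
    ContinuousOn (fun t => T t x) (Ici 0) := by
  intro a ha
  obtain ⟨M, hM⟩ := hT.exists_norm_le (a + 1)
  have hle : ∀ b ∈ Icc 0 (a + 1), ‖T b x - T a x‖ ≤ M * ‖T |b - a| x - x‖ := by
    have haux : ∀ u ∈ Icc 0 (a + 1), ∀ w, u ≤ w →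
        ‖T w x - T u x‖ ≤ M * ‖T (w - u) x - x‖ := by
      intro u hu w huw
      have h := hT.add_apply hu.1 (sub_nonneg.2 huw) x
      rw [add_sub_cancel] at h
      rw [h, ← map_sub]
      exact (T u).le_of_opNorm_le (hM u hu) _
    intro b hb
    rcases le_total a b with hab | hab
    · rw [abs_of_nonneg (sub_nonneg.2 hab)]
      exact haux a ⟨ha, by linarith⟩ b hab
    · rw [abs_sub_comm, abs_of_nonneg (sub_nonneg.2 hab), norm_sub_rev]
      exact haux b hb a hab
  rw [ContinuousWithinAt, tendsto_iff_norm_sub_tendsto_zero]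
  have habs : Tendsto (fun b : ℝ => |b - a|) (𝓝 a) (𝓝[≥] 0) := by
    refine tendsto_nhdsWithin_iff.2 ⟨?_, .of_forall fun b => mem_Ici.2 (abs_nonneg _)⟩
    have h : Continuous fun b : ℝ => |b - a| := by fun_prop
    simpa using h.tendsto a
  have hlim := (((hT.tendsto_norm_sub_nhdsGE x).comp habs).mono_left
    (nhdsWithin_le_nhds (s := Ici 0))).const_mul M
  rw [mul_zero] at hlim
  refine squeeze_zero' (.of_forall fun b => norm_nonneg _) ?_ hlim
  filter_upwards [self_mem_nhdsWithin, nhdsWithin_le_nhds (Iic_mem_nhds (lt_add_one a))]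
    with b hb₀ hb₁
  exact hle b ⟨hb₀, hb₁⟩

theorem eq_zero_of_apply_one_eq_smul (hT : IsStronglyContinuousSemigroup T) {u : B} {c : ℂ}
    (hc : ‖c‖ = 1) (hu : T 1 u = c • u)
    (hdense : ∀ z : ℂ, z • u ∈ closure ((fun t => T t u) '' Ici 0)) : u = 0 := by
  obtain ⟨M, hM⟩ := hT.exists_norm_le 1
  have hbound : ∀ n : ℕ, ∀ s ∈ Icc (0 : ℝ) 1, ‖T (s + n) u‖ ≤ M * ‖u‖ := by
    intro n s hs
    induction n with
    | zero => simpa using (T s).le_of_opNorm_le (hM s hs) u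
    | succ n ih =>
      have hn : (0 : ℝ) ≤ s + n := add_nonneg hs.1 n.cast_nonneg
      rw [Nat.cast_succ, ← add_assoc, hT.add_apply hn zero_le_one, hu, map_smul, norm_smul, hc,
        one_mul]
      exact ih
  have hsub : closure ((fun t => T t u) '' Ici 0) ⊆ Metric.closedBall 0 (M * ‖u‖) := by
    refine closure_minimal ?_ Metric.isClosed_closedBall
    rintro _ ⟨t, ht, rfl⟩
    rw [mem_closedBall_zero_iff]
    have h := hbound ⌊t⌋₊ (t - ⌊t⌋₊)
      ⟨sub_nonneg.2 (Nat.floor_le ht), by linarith [Nat.lt_floor_add_one t]⟩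
    rwa [sub_add_cancel] at h
  by_contra hne
  have hpos : 0 < ‖u‖ := norm_pos_iff.2 hne
  have h := hsub (hdense ((|M| + 1 : ℝ) : ℂ))
  rw [mem_closedBall_zero_iff, norm_smul, Complex.norm_real, Real.norm_eq_abs,
    abs_of_pos (by positivity)] at h
  nlinarith [le_of_mul_le_mul_right h hpos, le_abs_self M]

theorem eq_zero_of_aeval_prod_apply_eq_zero (hT : IsStronglyContinuousSemigroup T)
    (Λ : Finset ℂ) (e : ℂ → ℂ) (he : ∀ l ∈ Λ, ‖e l‖ = 1) {u : B}
    (hdense : ∀ z : ℂ, z • u ∈ closure ((fun t => T t u) '' Ici 0))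
    (hu : Polynomial.aeval (T 1) (∏ l ∈ Λ, (Polynomial.X - Polynomial.C (e l))) u = 0) :
    u = 0 := by
  induction Λ using Finset.cons_induction with
  | empty => simpa using hu
  | cons l Λ hl ih =>
    set A := Polynomial.aeval (T 1) (∏ l ∈ Λ, (Polynomial.X - Polynomial.C (e l))) with hA
    refine ih (fun m hm => he m (Finset.mem_cons_of_mem hm)) ?_
    rw [Finset.prod_cons, map_mul, ← hA] at hu
    have hu' : T 1 (A u) - e l • A u = 0 := by
      simpa [Algebra.algebraMap_eq_smul_one] using hu
    refine hT.eq_zero_of_apply_one_eq_smul (he l (Finset.mem_cons_self l Λ))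
      (sub_eq_zero.1 hu') fun z => ?_
    rw [← map_smul]
    refine map_mem_closure A.continuous (hdense z) ?_
    rintro _ ⟨t, ht, rfl⟩
    exact ⟨t, ht, hT.apply_aeval_apply _ ht u⟩

theorem apply_integral_periodic (hT : IsStronglyContinuousSemigroup T) {y : B} {p : ℝ}
    (hp : 0 < p) (hy : T p y = y) {l : ℂ} (hl : Complex.exp (l * p) = 1) {t : ℝ} (ht : 0 ≤ t) :
    T t (∫ s in (0 : ℝ)..p, Complex.exp (-(l * s)) • T s y) =
      Complex.exp (l * t) • ∫ s in (0 : ℝ)..p, Complex.exp (-(l * s)) • T s y := by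
  set G : ℝ → B := fun s => Complex.exp (-(l * s)) • T s y with hG
  have hGc : ContinuousOn G (Ici 0) :=
    ContinuousOn.smul (by fun_prop) (hT.continuousOn_orbit y)
  have hGi {a b : ℝ} (ha : 0 ≤ a) (hb : 0 ≤ b) : IntervalIntegrable G volume a b :=
    (hGc.mono fun s hs => le_trans (le_min ha hb) hs.1).intervalIntegrable
  have hGp {s : ℝ} (hs : 0 ≤ s) : G (s + p) = G s := by
    simp only [hG]
    rw [hT.add_apply hs hp.le, hy]
    congr 1
    push_cast
    rw [mul_add, neg_add, Complex.exp_add, Complex.exp_neg (l * p), hl, inv_one, mul_one]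
  have hshift : ∫ s in t..t + p, G s = ∫ s in (0 : ℝ)..p, G s := by
    have h₁ := intervalIntegral.integral_add_adjacent_intervals (hGi le_rfl ht)
      (hGi ht (add_nonneg ht hp.le))
    have h₂ := intervalIntegral.integral_add_adjacent_intervals (hGi le_rfl hp.le)
      (hGi hp.le (add_nonneg ht hp.le))
    have h₃ : ∫ s in p..t + p, G s = ∫ s in (0 : ℝ)..t, G s := by
      have := intervalIntegral.integral_comp_add_right (a := 0) (b := t) G p
      rw [zero_add] at this
      rw [← this]
      refine intervalIntegral.integral_congr fun s hs => hGp ?_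
      rw [uIcc_of_le ht] at hs
      exact hs.1
    rw [h₃, ← h₁, add_comm] at h₂
    exact (add_left_cancel h₂).symm
  rw [← ContinuousLinearMap.intervalIntegral_comp_comm _ (hGi le_rfl hp.le), ← hshift,
    ← intervalIntegral.integral_smul]
  have := intervalIntegral.integral_comp_add_left (a := 0) (b := p)
    (fun s => Complex.exp (l * t) • G s) t
  rw [add_zero] at this
  rw [← this]
  refine intervalIntegral.integral_congr fun s hs => ?_
  rw [uIcc_of_le hp.le] at hs
  simp only [hG, map_smul, smul_smul, hT.add_apply ht hs.1, ← Complex.exp_add]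
  congr 2
  push_cast
  ring

theorem apply_eq_zero_of_periodic (hT : IsStronglyContinuousSemigroup T) {A : B →L[ℂ] B}
    (hA : ∀ (w : B) (l : ℂ), l.re = 0 → w ≠ 0 →
      (∀ t : ℝ, 0 ≤ t → T t w = Complex.exp (l * t) • w) → A w = 0)
    {y : B} {p : ℝ} (hp : 0 < p) (hy : T p y = y) : A y = 0 := by
  refine SeparatingDual.eq_zero_of_forall_dual_eq_zero (R := ℂ) fun φ => ?_
  have hc : ContinuousOn (fun s => T s y) (Icc 0 p) :=
    (hT.continuousOn_orbit y).mono Icc_subset_Ici_self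
  have h := eq_zero_of_fourierCoeff_integral_eq_zero hp (g := fun s => φ (A (T s y)))
    ((φ.comp A).continuous.comp_continuousOn hc) (by simp only [hT.zero_apply, hy])
    (fun n => ?_) 0 ⟨le_rfl, hp⟩
  · simpa only [hT.zero_apply] using h
  set l : ℂ := 2 * Real.pi * Complex.I * n / p with hl
  have hlp : Complex.exp (l * p) = 1 := by
    rw [hl, div_mul_cancel₀ _ (Complex.ofReal_ne_zero.2 hp.ne'), Complex.exp_eq_one_iff]
    exact ⟨n, by ring⟩
  have hre : l.re = 0 := by
    rw [hl, show (2 * Real.pi * Complex.I * n / p : ℂ) = ((2 * Real.pi * n / p : ℝ) : ℂ) * Complex.I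
      by push_cast; ring]
    simp
  set w := ∫ s in (0 : ℝ)..p, Complex.exp (-(l * s)) • T s y with hw
  have hAw : A w = 0 := by
    by_cases hw0 : w = 0
    · rw [hw0, map_zero]
    · exact hA w l hre hw0 fun t ht => hT.apply_integral_periodic hp hy hlp ht
  have hi : IntervalIntegrable (fun s : ℝ => Complex.exp (-(l * s)) • T s y) volume 0 p := by
    refine ContinuousOn.intervalIntegrable ?_
    rw [uIcc_of_le hp.le]
    exact ContinuousOn.smul (by fun_prop) hc
  have := (φ.comp A).intervalIntegral_comp_comm hi
  rw [← hw, ContinuousLinearMap.comp_apply, hAw, map_zero] at this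
  simpa only [map_smul, ContinuousLinearMap.comp_apply, smul_eq_mul] using this

end Complete

end IsStronglyContinuousSemigroup


/-- If only finitely many purely imaginary `λ` admit a nonzero eigenvector
`v` with `T_t v = e^{λ t} v` for all `t ≥ 0`, then the strongly continuous semigroup
`(T_t)` is not subspace-chaotic: there is no nonzero closed invariant subspace `V`
on which the restricted semigroup is chaotic. -/
theorem stmt_2
    {B : Type*} [NormedAddCommGroup B] [NormedSpace ℂ B] [CompleteSpace B]
    (T : ℝ → B →L[ℂ] B)
    (hT0 : T 0 = ContinuousLinearMap.id ℂ B)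
    (hTsemi : ∀ t s : ℝ, 0 ≤ t → 0 ≤ s → T (t + s) = (T t).comp (T s))
    (hTcont : ∀ x : B,
      Filter.Tendsto (fun t : ℝ => ‖T t x - x‖) (nhdsWithin 0 (Set.Ioi 0)) (nhds 0))
    (hfin : {l : ℂ | l.re = 0 ∧ ∃ v : B, v ≠ 0 ∧
      ∀ t : ℝ, 0 ≤ t → T t v = Complex.exp (l * t) • v}.Finite) :
    ¬ ∃ V : Submodule ℂ B, IsClosed (V : Set B) ∧ V ≠ ⊥ ∧
      (∀ t : ℝ, 0 ≤ t → ∀ x ∈ V, T t x ∈ V) ∧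
      (∃ v ∈ V, ∀ x ∈ V, x ∈ closure {y : B | ∃ t : ℝ, 0 ≤ t ∧ T t v = y}) ∧
      (∀ x ∈ V, x ∈ closure {y : B | y ∈ V ∧ ∃ t : ℝ, 0 < t ∧ T t y = y}) := by
  rintro ⟨V, -, hVne, -, ⟨v, hv, hvd⟩, hper⟩
  have hT : IsStronglyContinuousSemigroup T := ⟨hT0, hTsemi, hTcont⟩
  set P := Polynomial.aeval (T 1)
    (∏ l ∈ hfin.toFinset, (Polynomial.X - Polynomial.C (Complex.exp l))) with hP
  have hPeig : ∀ (w : B) (l : ℂ), l.re = 0 → w ≠ 0 →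
      (∀ t : ℝ, 0 ≤ t → T t w = Complex.exp (l * t) • w) → P w = 0 := by
    intro w l hl hw h
    have hmem : l ∈ hfin.toFinset := hfin.mem_toFinset.2 ⟨hl, w, hw, h⟩
    have h₁ : T 1 w = Complex.exp l • w := by simpa using h 1 zero_le_one
    rw [hP, ← Finset.prod_erase_mul _ _ hmem, map_mul, mul_apply_eq_comp]
    simp [Algebra.algebraMap_eq_smul_one, h₁]
  have hPv : P v = 0 := by
    have hsub : closure {y : B | y ∈ V ∧ ∃ t : ℝ, 0 < t ∧ T t y = y} ⊆ {y | P y = 0} := by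
      refine closure_minimal ?_ (isClosed_eq P.continuous continuous_const)
      rintro y ⟨-, t, ht, hy⟩
      exact hT.apply_eq_zero_of_periodic hPeig ht hy
    exact hsub (hper v hv)
  have hv0 : v = 0 := by
    refine hT.eq_zero_of_aeval_prod_apply_eq_zero hfin.toFinset Complex.exp (fun l hl => ?_)
      (fun z => hvd _ (V.smul_mem z hv)) hPv
    rw [Complex.norm_exp, (hfin.mem_toFinset.1 hl).1, Real.exp_zero]
  refine hVne ((Submodule.eq_bot_iff V).2 fun x hx => ?_)
  have hsub : closure {y : B | ∃ t : ℝ, 0 ≤ t ∧ T t v = y} ⊆ {0} := by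
    refine closure_minimal ?_ isClosed_singleton
    rintro _ ⟨t, -, rfl⟩
    simp [hv0]
  exact hsub (hvd x hx)
end
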